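/- arXiv:1002.3507 — 3 statements merged into one kernel-verified Lean document; each statement's English description precedes it below -/
import Mathlib

section
/- Let H be a finite-dimensional complex Hilbert space and L : End(H) → End(H) a linear map. Then exp(tL) is a random unitary map for every t ≥ 0 (i.e., t ↦ exp(tL) is a random unitary semigroup) if and only if L belongs to C(H), the closure of the convex cone generated by {(A ↦ V A V* − A) : V unitary on H} in the space of linear maps on End(H). -/
/-- Conjugation `A ↦ V A V*` by an operator `V`, as a continuous linear map on `End(H)`. -/
noncomputable def conjCLM {H : Type*} [NormedAddCommGroup H] [InnerProductSpace ℂ H]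
    [FiniteDimensional ℂ H] (V : H →L[ℂ] H) :
    (H →L[ℂ] H) →L[ℂ] (H →L[ℂ] H) :=
  ContinuousLinearMap.mulLeftRight ℂ (H →L[ℂ] H) V (star V)

/-- The operator exponential `exp(L) = Σ_{k≥0} L^k / k!` of a (super)operator `L`. -/
noncomputable def superExp {H : Type*} [NormedAddCommGroup H] [InnerProductSpace ℂ H]
    [FiniteDimensional ℂ H] (L : (H →L[ℂ] H) →L[ℂ] (H →L[ℂ] H)) :
    (H →L[ℂ] H) →L[ℂ] (H →L[ℂ] H) :=
  ∑' k : ℕ, ((k.factorial : ℝ))⁻¹ • L ^ k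

open Filter Topology
open scoped Pointwise

theorem isCompact_convexHull_aux {E : Type*} [NormedAddCommGroup E] [NormedSpace ℝ E]
    [FiniteDimensional ℝ E] {s : Set E} (hs : IsCompact s) : IsCompact (convexHull ℝ s) := by
  classical
  set N := Module.finrank ℝ E + 1 with hN
  have hc : IsCompact ((stdSimplex ℝ (Fin N)) ×ˢ (Set.univ.pi fun _ : Fin N => s)) :=
    (isCompact_stdSimplex ℝ (Fin N)).prod (isCompact_univ_pi fun _ => hs)
  have hf : Continuous (fun p : (Fin N → ℝ) × (Fin N → E) => ∑ i, p.1 i • p.2 i) := by fun_prop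
  have := hc.image hf
  convert this using 1
  apply Set.Subset.antisymm
  · intro x hx
    have hne : s.Nonempty := by
      rw [← convexHull_nonempty_iff (𝕜 := ℝ)]; exact ⟨x, hx⟩
    obtain ⟨s0, hs0⟩ := hne
    obtain ⟨ι, _, z, w, hz, hai, hw, hw1, hx⟩ := eq_pos_convex_span_of_mem_convexHull hx
    have hcard : Fintype.card ι ≤ Fintype.card (Fin N) := by
      have h1 := hai.card_le_finrank_succ
      have h2 := Submodule.finrank_le (vectorSpan ℝ (Set.range z))
      simp only [Fintype.card_fin]; omega
    obtain ⟨e⟩ := Function.Embedding.nonempty_of_card_le hcard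
    refine ⟨(Function.extend e w 0, Function.extend e z (fun _ => s0)), ⟨⟨?_, ?_⟩, ?_⟩, ?_⟩
    · intro i
      by_cases h : ∃ a, e a = i
      · obtain ⟨a, rfl⟩ := h
        simp only [e.injective.extend_apply]; exact (hw a).le
      · simp [Function.extend_apply' _ _ _ h]
    · rw [← hw1]; symm
      refine Fintype.sum_of_injective e e.injective _ _ ?_ ?_
      · intro i hi
        exact Function.extend_apply' _ _ _ hi
      · intro a; simp only [e.injective.extend_apply]
    · intro i _
      by_cases h : ∃ a, e a = i
      · obtain ⟨a, rfl⟩ := h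
        simp only [e.injective.extend_apply]; exact hz ⟨a, rfl⟩
      · simpa [Function.extend_apply' _ _ _ h] using hs0
    · rw [← hx]; symm
      refine Fintype.sum_of_injective e e.injective _ _ ?_ ?_
      · intro i hi
        simp only
        rw [Function.extend_apply' w _ _ hi]; simp
      · intro a; simp only [e.injective.extend_apply]
  · rintro _ ⟨⟨w, z⟩, ⟨⟨hw, hw1⟩, hz⟩, rfl⟩
    exact (convex_convexHull ℝ s).sum_mem (fun i _ => hw i) hw1
      (fun i _ => subset_convexHull ℝ s (hz i trivial))

/-- in a closed convex submonoid, `exp (r (S - 1))` stays in the set -/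
theorem exp_mem_aux {A : Type*} [NormedRing A] [NormedAlgebra ℝ A] [CompleteSpace A]
    {K : Set A} (hK : Convex ℝ K) (hc : IsClosed K) (h1 : (1 : A) ∈ K)
    (hm : ∀ x ∈ K, ∀ y ∈ K, x * y ∈ K) {S : A} (hS : S ∈ K) {r : ℝ} (hr : 0 ≤ r) :
    NormedSpace.exp (r • (S - 1)) ∈ K := by
  let : NormedAlgebra ℚ A := NormedAlgebra.restrictScalars ℚ ℝ A
  have hpow : ∀ n : ℕ, S ^ n ∈ K := by
    intro n
    induction n with
    | zero => simpa using h1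
    | succ n ih => rw [pow_succ]; exact hm _ ih _ hS
  have e1 : NormedSpace.exp (r • (S - 1)) = (Real.exp r)⁻¹ • NormedSpace.exp (r • S) := by
    have h : r • (S - 1) = r • S + algebraMap ℝ A (-r) := by
      rw [Algebra.algebraMap_eq_smul_one, smul_sub, neg_smul, sub_eq_add_neg]
    rw [h, NormedSpace.exp_add_of_commute (Algebra.commutes _ _).symm,
      ← NormedSpace.algebraMap_exp_comm, ← Algebra.commutes, ← Algebra.smul_def,
      ← Real.exp_eq_exp_ℝ, Real.exp_neg]
  have ht1 : Tendsto (fun n : ℕ => ∑ k ∈ Finset.range n, ((k.factorial : ℝ)⁻¹ * r ^ k) • S ^ k)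
      atTop (𝓝 (NormedSpace.exp (r • S))) := by
    have := (NormedSpace.exp_series_hasSum_exp' (𝕂 := ℝ) (r • S)).tendsto_sum_nat
    simpa only [smul_pow, smul_smul] using this
  have ht2 : Tendsto (fun n : ℕ => ∑ k ∈ Finset.range n, ((k.factorial : ℝ)⁻¹ * r ^ k))
      atTop (𝓝 (Real.exp r)) := by
    have := (NormedSpace.exp_series_hasSum_exp' (𝕂 := ℝ) r).tendsto_sum_nat
    rw [Real.exp_eq_exp_ℝ]
    simpa only [smul_eq_mul] using this
  rw [e1]
  refine hc.mem_of_tendsto ((ht2.inv₀ (Real.exp_pos r).ne').smul ht1) ?_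
  filter_upwards [ht2.eventually (lt_mem_nhds (Real.exp_pos r))] with n hn
  have := hK.centerMass_mem (t := Finset.range n) (w := fun k => (k.factorial : ℝ)⁻¹ * r ^ k)
    (z := fun k => S ^ k) (fun i _ => by positivity) hn (fun i _ => hpow i)
  simpa [Finset.centerMass] using this

theorem conj_compact_aux {H : Type*} [NormedAddCommGroup H] [InnerProductSpace ℂ H]
    [FiniteDimensional ℂ H] :
    IsCompact {T : (H →L[ℂ] H) →L[ℂ] (H →L[ℂ] H) |
      ∃ V ∈ unitary (H →L[ℂ] H), T = conjCLM V} := by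
  have : CompleteSpace H := FiniteDimensional.complete ℂ H
  have : ProperSpace (H →L[ℂ] H) := FiniteDimensional.proper ℂ _
  have hu : IsCompact (unitary (H →L[ℂ] H) : Set (H →L[ℂ] H)) := by
    refine Metric.isCompact_of_isClosed_isBounded isClosed_unitary ?_
    refine (Metric.isBounded_closedBall (x := (0 : H →L[ℂ] H)) (r := 1)).subset ?_
    intro U hU
    rw [mem_closedBall_zero_iff]
    rcases subsingleton_or_nontrivial (H →L[ℂ] H) with h | h
    · simp [Subsingleton.elim U 0]
    · exact (CStarRing.norm_of_mem_unitary hU).le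
  have hcont : Continuous (fun V : H →L[ℂ] H => conjCLM V) := by
    unfold conjCLM
    fun_prop
  convert hu.image hcont using 1
  ext T
  simp [eq_comm]

theorem conj_mul_aux {H : Type*} [NormedAddCommGroup H] [InnerProductSpace ℂ H]
    [FiniteDimensional ℂ H] (U V : H →L[ℂ] H) :
    conjCLM U * conjCLM V = conjCLM (U * V) := by
  ext1 A
  simp [conjCLM, mul_assoc, ContinuousLinearMap.mulLeftRight_apply]

theorem hmul_aux {A : Type*} [NormedRing A] [NormedAlgebra ℝ A] {s : Set A} (hss : s * s ⊆ s) :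
    ∀ x ∈ convexHull ℝ s, ∀ y ∈ convexHull ℝ s, x * y ∈ convexHull ℝ s := by
  have h1 : ∀ x ∈ s, ∀ y ∈ convexHull ℝ s, x * y ∈ convexHull ℝ s := by
    intro x hx y hy
    have : convexHull ℝ s ⊆ (LinearMap.mulLeft ℝ x) ⁻¹' (convexHull ℝ s) :=
      convexHull_min (fun z hz => subset_convexHull ℝ s (hss ⟨x, hx, z, hz, rfl⟩))
        ((convex_convexHull ℝ s).linear_preimage _)
    exact this hy
  intro x hx y hy
  have : convexHull ℝ s ⊆ (LinearMap.mulRight ℝ y) ⁻¹' (convexHull ℝ s) :=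
    convexHull_min (fun z hz => h1 z hz y hy)
      ((convex_convexHull ℝ s).linear_preimage _)
  exact this hx

theorem abstract_aux {A : Type*} [NormedRing A] [NormedAlgebra ℝ A] [CompleteSpace A]
    {s : Set A} (hclosed : IsClosed (convexHull ℝ s)) (hone : (1 : A) ∈ convexHull ℝ s)
    (hmul : ∀ x ∈ convexHull ℝ s, ∀ y ∈ convexHull ℝ s, x * y ∈ convexHull ℝ s) (L : A) :
    (∀ t : ℝ, 0 ≤ t → ∑' k : ℕ, ((k.factorial : ℝ))⁻¹ • (t • L) ^ k ∈ convexHull ℝ s) ↔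
      L ∈ closure {T : A | ∃ r : ℝ, 0 ≤ r ∧ ∃ S ∈ convexHull ℝ (s - ({1} : Set A)), T = r • S} := by
  let : NormedAlgebra ℚ A := NormedAlgebra.restrictScalars ℚ ℝ A
  have hexp : ∀ x : A, ∑' k : ℕ, ((k.factorial : ℝ))⁻¹ • x ^ k = NormedSpace.exp x := by
    intro x
    rw [NormedSpace.exp_eq_tsum ℝ]
  simp only [hexp]
  rw [convexHull_sub, convexHull_singleton]
  constructor
  · intro h
    have hd := (hasDerivAt_exp_smul_const (𝕂 := ℝ) L 0).tendsto_slope_zero_right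
    simp only [zero_add, zero_smul, NormedSpace.exp_zero, one_mul] at hd
    refine mem_closure_of_tendsto hd ?_
    filter_upwards [self_mem_nhdsWithin] with t ht
    have ht : (0 : ℝ) < t := ht
    exact ⟨t⁻¹, by positivity, _, Set.sub_mem_sub (h t ht.le) rfl, rfl⟩
  · intro hL t ht
    have hcont : Continuous (fun T : A =>
        NormedSpace.exp (t • T)) :=
      NormedSpace.exp_continuous.comp (continuous_const_smul t)
    refine closure_minimal (t := (fun T : A =>
        NormedSpace.exp (t • T)) ⁻¹' (convexHull ℝ s)) ?_ (hclosed.preimage hcont) hL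
    rintro _ ⟨r, hr, _, ⟨S, hS, _, rfl, rfl⟩, rfl⟩
    have := exp_mem_aux (convex_convexHull ℝ s) hclosed hone hmul hS (mul_nonneg ht hr)
    simpa only [Set.mem_preimage, smul_smul] using this

theorem random_unitary_semigroup_iff_generator_in_cone
    {H : Type*} [NormedAddCommGroup H] [InnerProductSpace ℂ H] [FiniteDimensional ℂ H]
    (L : (H →L[ℂ] H) →L[ℂ] (H →L[ℂ] H)) :
    (∀ t : ℝ, 0 ≤ t →
        superExp (t • L)
          ∈ convexHull ℝ {T | ∃ V ∈ unitary (H →L[ℂ] H), T = conjCLM V}) ↔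
      L ∈ closure {T : (H →L[ℂ] H) →L[ℂ] (H →L[ℂ] H) |
        ∃ r : ℝ, 0 ≤ r ∧
          ∃ S ∈ convexHull ℝ {T' : (H →L[ℂ] H) →L[ℂ] (H →L[ℂ] H) |
            ∃ V ∈ unitary (H →L[ℂ] H),
              T' = conjCLM V - ContinuousLinearMap.id ℂ (H →L[ℂ] H)},
            T = r • S} := by
  have : CompleteSpace H := FiniteDimensional.complete ℂ H
  have : FiniteDimensional ℝ ((H →L[ℂ] H) →L[ℂ] (H →L[ℂ] H)) :=
    FiniteDimensional.complexToReal _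
  have : CompleteSpace ((H →L[ℂ] H) →L[ℂ] (H →L[ℂ] H)) := FiniteDimensional.complete ℂ _
  set s : Set ((H →L[ℂ] H) →L[ℂ] (H →L[ℂ] H)) :=
    {T | ∃ V ∈ unitary (H →L[ℂ] H), T = conjCLM V} with hs
  have hsub : {T' : (H →L[ℂ] H) →L[ℂ] (H →L[ℂ] H) |
            ∃ V ∈ unitary (H →L[ℂ] H),
              T' = conjCLM V - ContinuousLinearMap.id ℂ (H →L[ℂ] H)} =
      s - {(1 : (H →L[ℂ] H) →L[ℂ] (H →L[ℂ] H))} := by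
    ext T
    simp only [Set.sub_singleton, Set.mem_image, hs]
    constructor
    · rintro ⟨V, hV, rfl⟩
      exact ⟨_, ⟨V, hV, rfl⟩, rfl⟩
    · rintro ⟨_, ⟨V, hV, rfl⟩, rfl⟩
      exact ⟨V, hV, rfl⟩
  rw [hsub]
  have hclosed : IsClosed (convexHull ℝ s) :=
    (isCompact_convexHull_aux conj_compact_aux).isClosed
  have hone : (1 : (H →L[ℂ] H) →L[ℂ] (H →L[ℂ] H)) ∈ convexHull ℝ s := by
    refine subset_convexHull ℝ s ⟨1, one_mem _, ?_⟩
    ext1 A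
    simp [conjCLM, ContinuousLinearMap.mulLeftRight_apply]
  have hss : s * s ⊆ s := by
    rintro _ ⟨_, ⟨U, hU, rfl⟩, _, ⟨V, hV, rfl⟩, rfl⟩
    exact ⟨U * V, mul_mem hU hV, conj_mul_aux U V⟩
  exact abstract_aux hclosed hone (hmul_aux hss) L
end

section
/- Let H be a complex Hilbert space of finite dimension N and L : End(H) → End(H) a linear map. The following are equivalent. (c) L(A) = −i[Ĥ, A] + F(A) − ½(F*(1)·A + A·F*(1)) for all A, where Ĥ is a traceless selfadjoint operator on H, F(A) = Σ_{k=1}^{K} E_k A E_k + γ₀ 𝔘(A) with E_1, …, E_K selfadjoint operators, γ₀ ≥ 0, 𝔘 a random unitary map, and F* is the adjoint of F with respect to the Hilbert–Schmidt inner product on End(H). (d) L(A) = −i[Ĥ, A] + Σ_{k=1}^{N²−1} γ_k ( L_k A L_k − ½(L_k² A + A L_k²) ) + γ₀ (𝔘(A) − A) for all A, where Ĥ is a traceless selfadjoint operator, L_1, …, L_{N²−1} are traceless selfadjoint operators with ⟨L_j, L_k⟩_HS = δ_{jk}, 𝔘 is a random unitary map, and γ₀, …, γ_{N²−1} are nonnegative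 reals. -/
/-- A map on `End(H)` is a random unitary map if it is a finite convex combination of unitary
conjugations. -/
def IsRandomUnitary {H : Type*} [NormedAddCommGroup H] [InnerProductSpace ℂ H]
    [FiniteDimensional ℂ H] (𝔘 : (H →L[ℂ] H) → (H →L[ℂ] H)) : Prop :=
  ∃ (m : ℕ) (V : Fin m → (H →L[ℂ] H)) (p : Fin m → ℝ),
    (∀ k, V k ∈ unitary (H →L[ℂ] H)) ∧ (∀ k, 0 ≤ p k) ∧ (∑ k, p k = 1) ∧
    ∀ A, 𝔘 A = ∑ k, p k • (V k * A * star (V k))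

/-- The Hilbert–Schmidt inner product `⟨A, B⟩_HS = tr(A* B)` on `End(H)`. -/
noncomputable def hsInner {H : Type*} [NormedAddCommGroup H] [InnerProductSpace ℂ H]
    [FiniteDimensional ℂ H] (A B : H →L[ℂ] H) : ℂ :=
  LinearMap.trace ℂ H ((star A * B : H →L[ℂ] H) : H →ₗ[ℂ] H)


theorem diag_aux {T : Type*} [AddCommGroup T] [Module ℝ T] [FiniteDimensional ℝ T]
    (B : T →ₗ[ℝ] T →ₗ[ℝ] ℝ) (hs : ∀ x y, B x y = B y x) (hp : ∀ x, 0 ≤ B x x)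
    (hd : ∀ x, B x x = 0 → x = 0) {n : ℕ} (hn : Module.finrank ℝ T = n)
    {K : ℕ} (e : Fin K → T) {W : Type*} [AddCommGroup W] [Module ℝ W]
    (D : T →ₗ[ℝ] T →ₗ[ℝ] W) :
    ∃ (b : Fin n → T) (γ : Fin n → ℝ), (∀ i j, B (b i) (b j) = if i = j then 1 else 0) ∧
      (∀ i, 0 ≤ γ i) ∧ ∑ k, D (e k) (e k) = ∑ j, γ j • D (b j) (b j) := by
  let core : InnerProductSpace.Core ℝ T :=
    { inner := fun x y => B x y
      conj_inner_symm := fun x y => by simp [hs y x]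
      re_inner_nonneg := fun x => by simpa using hp x
      add_left := fun x y z => by simp
      smul_left := fun x y r => by simp
      definite := hd }
  let _ : NormedAddCommGroup T := core.toNormedAddCommGroup
  let _ : InnerProductSpace ℝ T := InnerProductSpace.ofCore core.toCore
  have hin : ∀ x y : T, inner ℝ x y = B x y := fun x y => rfl
  let S : T →ₗ[ℝ] T := ∑ k, (B (e k)).smulRight (e k)
  have hS : ∀ x, S x = ∑ k, B (e k) x • e k := fun x => by
    simp [S]
  have hBS : ∀ x y, B x (S y) = ∑ k, B (e k) x * B (e k) y := fun x y => by
    rw [hS, map_sum]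
    refine Finset.sum_congr rfl fun k _ => ?_
    rw [map_smul, smul_eq_mul, hs x, mul_comm]
  have hsym : S.IsSymmetric := fun x y => by
    rw [hin, hin, hs, hBS, hBS]
    exact Finset.sum_congr rfl fun k _ => mul_comm _ _
  let b := hsym.eigenvectorBasis hn
  have hb : ∀ i j, B (b i) (b j) = if i = j then 1 else 0 := fun i j => by
    rw [← hin]
    exact orthonormal_iff_ite.mp b.orthonormal i j
  have hSb : ∀ j, S (b j) = hsym.eigenvalues hn j • b j := fun j => by
    exact hsym.apply_eigenvectorBasis hn j
  have hij : ∀ i j, ∑ k, B (e k) (b i) * B (e k) (b j)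
      = if i = j then hsym.eigenvalues hn j else 0 := fun i j => by
    rw [← hBS, hSb, map_smul, hb]
    simp
  refine ⟨b, hsym.eigenvalues hn, hb, fun i => ?_, ?_⟩
  · have := hij i i
    rw [if_pos rfl] at this
    rw [← this]
    exact Finset.sum_nonneg fun k _ => mul_self_nonneg _
  · have hexp : ∀ x : T, x = ∑ i, B x (b i) • b i := fun x => by
      conv_lhs => rw [← b.sum_repr' x]
      refine Finset.sum_congr rfl fun i _ => ?_
      rw [hin, hs]
    have h1 : ∀ k, D (e k) (e k) = ∑ i, ∑ j, (B (e k) (b i) * B (e k) (b j)) • D (b i) (b j) := by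
      intro k
      conv_lhs => rw [hexp (e k)]
      simp only [map_sum, map_smul, LinearMap.sum_apply, LinearMap.smul_apply, Finset.smul_sum,
        smul_smul]
      rw [Finset.sum_comm]
      refine Finset.sum_congr rfl fun i _ => Finset.sum_congr rfl fun j _ => ?_
      congr 1
      ring
    simp only [h1]
    rw [Finset.sum_comm]
    refine Finset.sum_congr rfl fun i _ => ?_
    rw [Finset.sum_comm]
    simp only [← Finset.sum_smul, hij]
    simp

section
variable {H : Type*} [NormedAddCommGroup H] [InnerProductSpace ℂ H] [FiniteDimensional ℂ H]

theorem hs_sum (A B : H →L[ℂ] H) :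
    hsInner A B = ∑ i, inner ℂ (A (stdOrthonormalBasis ℂ H i)) (B (stdOrthonormalBasis ℂ H i)) := by
  unfold hsInner
  rw [LinearMap.trace_eq_sum_inner _ (stdOrthonormalBasis ℂ H)]
  refine Finset.sum_congr rfl fun i _ => ?_
  simp [ContinuousLinearMap.star_eq_adjoint, ContinuousLinearMap.adjoint_inner_right]

/-- trace as a linear functional -/
noncomputable def trc : (H →L[ℂ] H) →ₗ[ℂ] ℂ where
  toFun A := LinearMap.trace ℂ H (A : H →ₗ[ℂ] H)
  map_add' A B := by simp
  map_smul' c A := by simp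

theorem trc_def (A : H →L[ℂ] H) : LinearMap.trace ℂ H (A : H →ₗ[ℂ] H) = trc A := rfl

theorem hs_trc (A B : H →L[ℂ] H) : hsInner A B = trc (star A * B) := rfl

theorem trc_comm (A B : H →L[ℂ] H) : trc (A * B) = trc (B * A) := by
  have := LinearMap.trace_mul_comm ℂ (A : H →ₗ[ℂ] H) (B : H →ₗ[ℂ] H)
  exact this

theorem hs_conj (A B : H →L[ℂ] H) : hsInner A B = starRingEnd ℂ (hsInner B A) := by
  rw [hs_sum, hs_sum, map_sum]
  simp

theorem trc_star (A : H →L[ℂ] H) : trc (star A) = starRingEnd ℂ (trc A) := by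
  have := hs_conj A 1
  simpa [hs_trc] using this

theorem hs_self (A : H →L[ℂ] H) :
    hsInner A A = ((∑ i, ‖A (stdOrthonormalBasis ℂ H i)‖ ^ 2 : ℝ) : ℂ) := by
  rw [hs_sum]
  push_cast
  refine Finset.sum_congr rfl fun i _ => ?_
  exact inner_self_eq_norm_sq_to_K _

theorem hs_def (A : H →L[ℂ] H) (h : (hsInner A A).re = 0) : A = 0 := by
  rw [hs_self, Complex.ofReal_re, Finset.sum_eq_zero_iff_of_nonneg (fun _ _ => by positivity)] at h
  have : (A : H →ₗ[ℂ] H) = 0 := by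
    apply (stdOrthonormalBasis ℂ H).toBasis.ext
    intro i
    simpa using h i (Finset.mem_univ i)
  ext x
  exact congrArg (fun f : H →ₗ[ℂ] H => f x) this

theorem hs_ext (A B : H →L[ℂ] H) (h : ∀ C, hsInner A C = hsInner B C) : A = B := by
  have : A - B = 0 := by
    apply hs_def
    have := h (A - B)
    rw [hs_trc, hs_trc] at this
    rw [hs_trc, star_sub, sub_mul, map_sub, this, sub_self, Complex.zero_re]
  exact sub_eq_zero.mp this

theorem trc_one : trc (1 : H →L[ℂ] H) = (Module.finrank ℂ H : ℂ) := by
  have := LinearMap.trace_one ℂ H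
  exact this

theorem trc_sa {A : H →L[ℂ] H} (h : IsSelfAdjoint A) : ((trc A).re : ℂ) = trc A := by
  rw [← Complex.conj_eq_iff_re, ← trc_star, h.star_eq]

instance finReal : FiniteDimensional ℝ (H →L[ℂ] H) := FiniteDimensional.complexToReal _

theorem finrank_CLM : Module.finrank ℂ (H →L[ℂ] H) = Module.finrank ℂ H ^ 2 := by
  rw [LinearEquiv.finrank_eq (LinearMap.toContinuousLinearMap (𝕜 := ℂ) (E := H) (F' := H)).symm,
    Module.finrank_linearMap, sq]

/-- selfadjoint operators as a real subspace -/
noncomputable def SA (H : Type*) [NormedAddCommGroup H] [InnerProductSpace ℂ H]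
    [FiniteDimensional ℂ H] : Submodule ℝ (H →L[ℂ] H) := selfAdjoint.submodule ℝ (H →L[ℂ] H)

theorem mem_SA {A : H →L[ℂ] H} : A ∈ SA H ↔ star A = A := Iff.rfl

/-- multiplication by i -/
noncomputable def mulI : (H →L[ℂ] H) →ₗ[ℝ] (H →L[ℂ] H) where
  toFun A := Complex.I • A
  map_add' A B := smul_add _ _ _
  map_smul' c A := smul_comm _ _ _

theorem finrank_sa : Module.finrank ℝ (SA H) = Module.finrank ℂ H ^ 2 := by
  have h1 := finrank_real_of_complex (H →L[ℂ] H)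
  let φ : (SA H × SA H) →ₗ[ℝ] (H →L[ℂ] H) :=
    LinearMap.coprod (SA H).subtype (mulI.comp (SA H).subtype)
  have hφ : ∀ x y, φ (x, y) = (x : H →L[ℂ] H) + Complex.I • (y : H →L[ℂ] H) := fun x y => rfl
  have hb : Function.Bijective φ := by
    constructor
    · rw [injective_iff_map_eq_zero]
      rintro ⟨⟨x, hx⟩, ⟨y, hy⟩⟩ h
      rw [hφ] at h
      simp only at h
      rw [mem_SA] at hx hy
      have h' := congrArg star h
      simp only [star_add, star_smul, hx, hy, star_zero] at h'
      have e : star Complex.I = -Complex.I := Complex.conj_I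
      rw [e] at h'
      have hx0 : x = 0 := by
        have : x = (2 : ℂ)⁻¹ • ((x + Complex.I • y) + (x + -Complex.I • y)) := by module
        rw [this, h, h']; simp
      have hy0 : y = 0 := by
        rw [hx0, zero_add] at h
        exact (smul_eq_zero.mp h).resolve_left Complex.I_ne_zero
      subst hx0 hy0
      rfl
    · intro a
      refine ⟨(⟨realPart a, (realPart a).2⟩, ⟨imaginaryPart a, (imaginaryPart a).2⟩), ?_⟩
      rw [hφ]
      exact realPart_add_I_smul_imaginaryPart a
  have h2 := (LinearEquiv.ofBijective φ hb).finrank_eq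
  rw [Module.finrank_prod] at h2
  rw [finrank_CLM] at h1
  omega

/-- real trace -/
noncomputable def tau : (H →L[ℂ] H) →ₗ[ℝ] ℝ where
  toFun A := (trc A).re
  map_add' A B := by simp
  map_smul' c A := by
    rw [← Complex.coe_smul, map_smul]; simp

/-- traceless selfadjoint operators -/
noncomputable def TS (H : Type*) [NormedAddCommGroup H] [InnerProductSpace ℂ H]
    [FiniteDimensional ℂ H] : Submodule ℝ (H →L[ℂ] H) :=
  (LinearMap.ker (tau.domRestrict (SA H))).map (SA H).subtype

theorem mem_TS {A : H →L[ℂ] H} : A ∈ TS H ↔ IsSelfAdjoint A ∧ trc A = 0 := by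
  constructor
  · rintro ⟨⟨x, hx⟩, h, rfl⟩
    have hx' : IsSelfAdjoint x := hx
    refine ⟨hx', ?_⟩
    have h' : (trc x).re = 0 := h
    change trc x = 0
    rw [← trc_sa hx', h', Complex.ofReal_zero]
  · rintro ⟨h1, h2⟩
    refine ⟨⟨A, h1⟩, ?_, rfl⟩
    change (trc A).re = 0
    rw [h2, Complex.zero_re]

theorem finrank_T : Module.finrank ℝ (TS H) = Module.finrank ℂ H ^ 2 - 1 := by
  have h := LinearMap.finrank_range_add_finrank_ker (tau.domRestrict (SA H))
  have he : Module.finrank ℝ (TS H) = Module.finrank ℝ (LinearMap.ker (tau.domRestrict (SA H))) :=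
    (LinearEquiv.finrank_eq (Submodule.equivMapOfInjective (SA H).subtype
      (SA H).injective_subtype (LinearMap.ker (tau.domRestrict (SA H))))).symm
  rw [finrank_sa, ← he] at h
  rcases Nat.eq_zero_or_pos (Module.finrank ℂ H) with h0 | h0
  · have : Module.finrank ℂ H ^ 2 = 0 := by rw [h0]; rfl
    omega
  · have : LinearMap.range (tau.domRestrict (SA H)) = ⊤ := by
      apply LinearMap.range_eq_top.mpr
      apply LinearMap.surjective
      intro hc
      have := LinearMap.congr_fun hc ⟨1, IsSelfAdjoint.one _⟩
      have h2 : (trc (1 : H →L[ℂ] H)).re = 0 := this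
      rw [trc_one, Complex.natCast_re, Nat.cast_eq_zero] at h2
      omega
    rw [this, finrank_top, Module.finrank_self] at h
    omega

/-- real HS form -/
noncomputable def hsB : TS H →ₗ[ℝ] TS H →ₗ[ℝ] ℝ :=
  LinearMap.mk₂ ℝ (fun x y => tau ((x : H →L[ℂ] H) * (y : H →L[ℂ] H)))
    (fun x y z => by rw [Submodule.coe_add, add_mul, map_add])
    (fun c x y => by rw [Submodule.coe_smul, smul_mul_assoc, map_smul])
    (fun x y z => by rw [Submodule.coe_add, mul_add, map_add])
    (fun c x y => by rw [Submodule.coe_smul, mul_smul_comm, map_smul])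

theorem hsB_hs (x y : TS H) :
    ((hsB x y : ℝ) : ℂ) = hsInner (x : H →L[ℂ] H) (y : H →L[ℂ] H) := by
  have h1 : star (x : H →L[ℂ] H) = x := (mem_TS.mp x.2).1
  have h2 : star (y : H →L[ℂ] H) = y := (mem_TS.mp y.2).1
  have h3 : hsInner (x : H →L[ℂ] H) (y : H →L[ℂ] H)
      = trc ((x : H →L[ℂ] H) * (y : H →L[ℂ] H)) := by rw [hs_trc, h1]
  rw [h3]
  change (((trc ((x : H →L[ℂ] H) * (y : H →L[ℂ] H))).re : ℝ) : ℂ) = _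
  rw [← Complex.conj_eq_iff_re, ← trc_star, star_mul, h1, h2, trc_comm]

/-- dissipator as bilinear form -/
noncomputable def dis (X Y A : H →L[ℂ] H) : H →L[ℂ] H :=
  X * A * Y - (2 : ℂ)⁻¹ • (X * Y * A + A * (X * Y))

/-- dissipator -/
noncomputable def disB : TS H →ₗ[ℝ] TS H →ₗ[ℝ]
    ((H →L[ℂ] H) → (H →L[ℂ] H)) :=
  LinearMap.mk₂ ℝ (fun x y A => dis (x : H →L[ℂ] H) (y : H →L[ℂ] H) A)
    (fun x y z => by
      ext1 A
      simp only [dis, Pi.add_apply, Submodule.coe_add, add_mul, mul_add,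
        smul_add]
      abel)
    (fun c x y => by
      ext1 A
      simp only [dis, Pi.smul_apply, Submodule.coe_smul, smul_sub, smul_add, smul_mul_assoc, mul_smul_comm,
        smul_comm c])
    (fun x y z => by
      ext1 A
      simp only [dis, Pi.add_apply, Submodule.coe_add, add_mul, mul_add,
        smul_add]
      abel)
    (fun c x y => by
      ext1 A
      simp only [dis, Pi.smul_apply, Submodule.coe_smul, smul_sub, smul_add, smul_mul_assoc, mul_smul_comm,
        smul_comm c])

theorem dis_shift (X A : H →L[ℂ] H) (c : ℂ) :
    dis (X - c • 1) (X - c • 1) A = dis X X A := by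
  have h2 : ∀ x : H →L[ℂ] H, x = (2 : ℂ)⁻¹ • x + (2 : ℂ)⁻¹ • x := fun x => by
    rw [← add_smul]; norm_num
  unfold dis
  simp only [sub_mul, mul_sub, smul_mul_assoc, mul_smul_comm, one_mul, mul_one, smul_sub, smul_add,
    mul_assoc, smul_smul]
  module

/-- explicit adjoint -/
theorem adj_aux {K : ℕ} (E : Fin K → (H →L[ℂ] H)) (hE : ∀ k, IsSelfAdjoint (E k)) (γ₀ : ℝ)
    {𝔘 : (H →L[ℂ] H) → (H →L[ℂ] H)} (hU : IsRandomUnitary 𝔘) :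
    ∃ G : (H →L[ℂ] H) → (H →L[ℂ] H),
      (∀ A B : H →L[ℂ] H, hsInner (G A) B = hsInner A ((∑ k, E k * B * E k) + γ₀ • 𝔘 B)) ∧
      G 1 = (∑ k, E k * E k) + γ₀ • 1 := by
  obtain ⟨m, V, p, hV, hp, hp1, hU⟩ := hU
  refine ⟨fun A => (∑ k, E k * A * E k) + γ₀ • ∑ k, p k • (star (V k) * A * V k), ?_, ?_⟩
  · intro A B
    rw [hU]
    simp only [hs_trc, star_add, star_sum, star_smul, star_mul, star_star, add_mul, mul_add,
      Finset.sum_mul, Finset.mul_sum, map_add, map_sum, (hE _).star_eq, smul_mul_assoc,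
      mul_smul_comm, star_trivial, Finset.smul_sum]
    congr 1
    · refine Finset.sum_congr rfl fun k _ => ?_
      rw [← mul_assoc, ← mul_assoc, trc_comm]
      simp only [mul_assoc]
      rw [trc_comm]
      simp only [mul_assoc]
      rw [trc_comm]
      simp only [mul_assoc]
    · refine Finset.sum_congr rfl fun k _ => ?_
      have : trc (star (V k) * (star A * V k) * B) = trc (star A * (V k * B * star (V k))) := by
        rw [mul_assoc, trc_comm]
        simp only [mul_assoc]
      simp only [← Complex.coe_smul, map_smul, this]
  · simp only [mul_one]
    congr 2
    rw [← one_smul ℝ (1 : H →L[ℂ] H), ← hp1, Finset.sum_smul]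
    refine Finset.sum_congr rfl fun k _ => ?_
    rw [(Unitary.mem_iff.mp (hV k)).1]

end

section
variable {H : Type*} [NormedAddCommGroup H] [InnerProductSpace ℂ H] [FiniteDimensional ℂ H]

theorem shift_mem (X : H →L[ℂ] H) (hX : IsSelfAdjoint X) :
    X - ((((trc X).re / (Module.finrank ℂ H : ℝ) : ℝ)) : ℂ) • (1 : H →L[ℂ] H) ∈ TS H := by
  rw [mem_TS]
  constructor
  · apply hX.sub
    rw [isSelfAdjoint_iff, star_smul, star_one]
    congr 1
    exact Complex.conj_ofReal _
  · rw [map_sub, map_smul, trc_one]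
    rcases Nat.eq_zero_or_pos (Module.finrank ℂ H) with h0 | h0
    · have : Subsingleton H := Module.finrank_zero_iff.mp h0
      have hX0 : X = 0 := by ext x; exact Subsingleton.elim _ _
      simp [hX0]
    · have h1 : (Module.finrank ℂ H : ℂ) ≠ 0 := by exact_mod_cast h0.ne'
      push_cast
      rw [trc_sa hX, smul_eq_mul, div_mul_cancel₀ _ h1, sub_self]

theorem gen_eq {K : ℕ} (E : Fin K → (H →L[ℂ] H)) (γ₀ : ℝ) (A Z U : H →L[ℂ] H) :
    Z + ((∑ k, E k * A * E k) + γ₀ • U)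
      - (2 : ℂ)⁻¹ • (((∑ k, E k * E k) + γ₀ • 1) * A + A * ((∑ k, E k * E k) + γ₀ • 1))
    = Z + (∑ k, dis (E k) (E k) A) + γ₀ • (U - A) := by
  simp only [dis, Finset.sum_sub_distrib, ← Finset.smul_sum, Finset.sum_add_distrib, add_mul,
    mul_add, ← Finset.sum_mul, ← Finset.mul_sum, smul_mul_assoc, mul_smul_comm, one_mul, mul_one,
    ← Complex.coe_smul]
  module

end

/-- Equivalence of the two forms (c) and (d) of the generator of a random
unitary semigroup on `End(H)`, `dim H = N`. -/
theorem generator_form_c_iff_d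
    {H : Type*} [NormedAddCommGroup H] [InnerProductSpace ℂ H] [FiniteDimensional ℂ H]
    (L : (H →L[ℂ] H) →ₗ[ℂ] (H →L[ℂ] H)) :
    -- (c)
    (∃ Hh : H →L[ℂ] H, IsSelfAdjoint Hh ∧
        LinearMap.trace ℂ H (Hh : H →ₗ[ℂ] H) = 0 ∧
      ∃ (K : ℕ) (E : Fin K → (H →L[ℂ] H)), (∀ k, IsSelfAdjoint (E k)) ∧
      ∃ γ₀ : ℝ, 0 ≤ γ₀ ∧
      ∃ 𝔘 : (H →L[ℂ] H) → (H →L[ℂ] H), IsRandomUnitary 𝔘 ∧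
      ∃ Fst : (H →L[ℂ] H) → (H →L[ℂ] H),
        (∀ A B : H →L[ℂ] H,
          hsInner (Fst A) B = hsInner A ((∑ k, E k * B * E k) + γ₀ • 𝔘 B)) ∧
        ∀ A : H →L[ℂ] H,
          L A = -(Complex.I) • (Hh * A - A * Hh)
            + ((∑ k, E k * A * E k) + γ₀ • 𝔘 A)
            - (2 : ℂ)⁻¹ • (Fst 1 * A + A * Fst 1)) ↔
    -- (d)
    (∃ Hh : H →L[ℂ] H, IsSelfAdjoint Hh ∧
        LinearMap.trace ℂ H (Hh : H →ₗ[ℂ] H) = 0 ∧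
      ∃ Lops : Fin ((Module.finrank ℂ H) ^ 2 - 1) → (H →L[ℂ] H),
        (∀ k, IsSelfAdjoint (Lops k)) ∧
        (∀ k, LinearMap.trace ℂ H (Lops k : H →ₗ[ℂ] H) = 0) ∧
        (∀ j k, hsInner (Lops j) (Lops k) = if j = k then 1 else 0) ∧
      ∃ 𝔘 : (H →L[ℂ] H) → (H →L[ℂ] H), IsRandomUnitary 𝔘 ∧
      ∃ (γ₀ : ℝ) (γ : Fin ((Module.finrank ℂ H) ^ 2 - 1) → ℝ),
        0 ≤ γ₀ ∧ (∀ k, 0 ≤ γ k) ∧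
        ∀ A : H →L[ℂ] H,
          L A = -(Complex.I) • (Hh * A - A * Hh)
            + (∑ k, γ k •
                (Lops k * A * Lops k
                  - (2 : ℂ)⁻¹ • (Lops k ^ 2 * A + A * Lops k ^ 2)))
            + γ₀ • (𝔘 A - A)) := by
  constructor
  · rintro ⟨Hh, hH, hH0, K, E, hE, γ₀, hγ, 𝔘, hU, Fst, hF, hL⟩
    obtain ⟨G, hG, hG1⟩ := adj_aux E hE γ₀ hU
    have hF1 : Fst 1 = (∑ k, E k * E k) + γ₀ • 1 := by
      rw [← hG1]
      exact hs_ext _ _ fun C => by rw [hF, hG]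
    obtain ⟨b, γ, hb, hγ', hsum⟩ := diag_aux (hsB (H := H))
      (fun x y => by
        change tau _ = tau _
        change (trc _).re = (trc _).re
        rw [trc_comm])
      (fun x => by
        have h := hsB_hs x x
        rw [hs_self, Complex.ofReal_inj] at h
        rw [h]
        positivity)
      (fun x hx => by
        have h := hsB_hs x x
        rw [hx] at h
        exact Subtype.ext (hs_def _ (by rw [← h]; rfl)))
      finrank_T (fun k => ⟨_, shift_mem (E k) (hE k)⟩) disB
    refine ⟨Hh, hH, hH0, fun k => b k, fun k => (mem_TS.mp (b k).2).1,
      fun k => (mem_TS.mp (b k).2).2, fun j k => ?_, 𝔘, hU, γ₀, γ, hγ, hγ', fun A => ?_⟩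
    · rw [← hsB_hs, hb]
      split_ifs <;> simp
    · rw [hL, hF1, gen_eq]
      congr 2
      have h := congrFun hsum A
      rw [Finset.sum_apply, Finset.sum_apply] at h
      have h1 : ∀ k, dis (E k) (E k) A = disB ⟨_, shift_mem (E k) (hE k)⟩
          ⟨_, shift_mem (E k) (hE k)⟩ A := fun k => (dis_shift (E k) A _).symm
      simp only [h1]
      rw [h]
      refine Finset.sum_congr rfl fun k _ => ?_
      rw [sq]
      rfl
  · rintro ⟨Hh, hH, hH0, Lops, hS, hT, hO, 𝔘, hU, γ₀, γ, hγ0, hγ, hL⟩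
    have hE : ∀ k, IsSelfAdjoint (Real.sqrt (γ k) • Lops k) := fun k => by
      rw [isSelfAdjoint_iff, star_smul, (hS k).star_eq, star_trivial]
    obtain ⟨G, hG, hG1⟩ := adj_aux _ hE γ₀ hU
    refine ⟨Hh, hH, hH0, _, fun k => Real.sqrt (γ k) • Lops k, hE, γ₀, hγ0, 𝔘, hU, G, hG,
      fun A => ?_⟩
    rw [hG1, gen_eq, hL]
    congr 2
    refine Finset.sum_congr rfl fun k _ => ?_
    have hs : Real.sqrt (γ k) * Real.sqrt (γ k) = γ k := Real.mul_self_sqrt (hγ k)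
    simp only [dis, smul_mul_assoc, mul_smul_comm, smul_smul, hs, smul_sub, smul_add, sq,
      smul_comm (γ k)]
end

section
/- Let H be a complex Hilbert space of finite dimension N, let X_1, …, X_n be skewadjoint operators on H, let b^1, …, b^n be real numbers and [a^{jk}] a positive semidefinite symmetric real n×n matrix, and define the linear map 𝔊 : End(H) → End(H) by 𝔊(A) = Σ_{j=1}^{n} b^j (X_j A − A X_j) + Σ_{j,k=1}^{n} a^{jk} (X_j X_k A + A X_j X_k − 2 X_j A X_k). Let V be the image of the real span of iX_1, …, iX_n under the projection B ↦ B − (tr(B)/N)·1 of selfadjoint operators onto the traceless selfadjoint operators, and let D = dim_ℝ V. Then there exist a selfadjoint operator Ĥ ∈ V, selfadjoint operators F_1, …, F_D ∈ V with ⟨F_j, F_k⟩_HS = δ_{jk}, and nonnegative reals γ_1, …, γ_D, such that 𝔊(A) = −i(Ĥ A − A Ĥ) + Σ_{k=1}^{D} γ_k ( F_k A F_k − ½(F_k² A + A F_k²) ) for all A ∈ End(H). -/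
theorem ggcf_abs {E : Type*} [NormedAddCommGroup E] [InnerProductSpace ℝ E] [FiniteDimensional ℝ E]
    {n : ℕ} (y : Fin n → E) (a : Matrix (Fin n) (Fin n) ℝ) (hpos : a.PosSemidef) :
    ∃ (F : OrthonormalBasis (Fin (Module.finrank ℝ E)) ℝ E)
      (g : Fin (Module.finrank ℝ E) → ℝ), (∀ k, 0 ≤ g k) ∧
      ∀ l m, ∑ j, ∑ k, a j k * (inner ℝ (F l) (y j) * inner ℝ (F m) (y k)) =
        if l = m then g l else 0 := by
  have hsymm : ∀ j k, a j k = a k j := fun j k => by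
    have := hpos.1.apply k j
    simpa using this
  let T : E →ₗ[ℝ] E := ∑ j, ∑ k, a j k • ((innerₗ E (y j)).smulRight (y k))
  have hT : ∀ u v, inner ℝ (T u) v =
      ∑ j, ∑ k, a j k * (inner ℝ u (y j) * inner ℝ v (y k)) := by
    intro u v
    simp only [T, LinearMap.sum_apply, LinearMap.smul_apply, LinearMap.smulRight_apply,
      innerₗ_apply_apply, sum_inner, inner_smul_left]
    simp [real_inner_comm]
  have hS : T.IsSymmetric := by
    intro u v
    rw [real_inner_comm (T v) u, hT, hT, Finset.sum_comm]
    refine Finset.sum_congr rfl fun j _ => Finset.sum_congr rfl fun k _ => ?_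
    rw [hsymm k j]; ring
  have hP : ∀ u, 0 ≤ inner ℝ (T u) u := by
    intro u
    rw [hT]
    have := hpos.dotProduct_mulVec_nonneg (fun j => inner ℝ u (y j))
    simp only [dotProduct, Matrix.mulVec, Finset.mul_sum] at this
    refine this.trans_eq (Finset.sum_congr rfl fun j _ => Finset.sum_congr rfl fun k _ => ?_)
    simp only [Pi.star_apply, star_trivial]
    ring
  have key : ∀ l m, inner ℝ (T (hS.eigenvectorBasis rfl l)) (hS.eigenvectorBasis rfl m)
      = if l = m then hS.eigenvalues rfl l else 0 := by
    intro l m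
    rw [hS.apply_eigenvectorBasis, inner_smul_left,
      orthonormal_iff_ite.mp (hS.eigenvectorBasis rfl).orthonormal]
    simp
  refine ⟨hS.eigenvectorBasis rfl, hS.eigenvalues rfl, fun k => ?_, fun l m => ?_⟩
  · have := hP (hS.eigenvectorBasis rfl k)
    rw [key] at this
    simpa using this
  · rw [← key, hT]

theorem ggcf_bilin {E : Type*} [AddCommGroup E] [Module ℝ E] [FiniteDimensional ℝ E]
    (B : E →ₗ[ℝ] E →ₗ[ℝ] ℝ) (hB : ∀ u v, B u v = B v u) (hB0 : ∀ u, 0 ≤ B u u)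
    (hB1 : ∀ u, B u u = 0 → u = 0)
    {n : ℕ} (y : Fin n → E) (a : Matrix (Fin n) (Fin n) ℝ) (hpos : a.PosSemidef) :
    ∃ (F : Fin (Module.finrank ℝ E) → E)
      (g : Fin (Module.finrank ℝ E) → ℝ), (∀ k, 0 ≤ g k) ∧
      (∀ l m, B (F l) (F m) = if l = m then 1 else 0) ∧
      ∀ {W : Type _} [AddCommGroup W] [Module ℝ W] (φ : E →ₗ[ℝ] E →ₗ[ℝ] W),
        ∑ j, ∑ k, a j k • φ (y j) (y k) = ∑ l, g l • φ (F l) (F l) := by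
  let core : InnerProductSpace.Core ℝ E :=
    { inner := fun u v => B u v
      conj_inner_symm := fun u v => by simpa using hB v u
      re_inner_nonneg := fun u => by simpa using hB0 u
      add_left := fun u v w => by simp
      smul_left := fun u v r => by simp
      definite := fun u h => hB1 u h }
  let _ : NormedAddCommGroup E := core.toNormedAddCommGroup
  let _ : InnerProductSpace ℝ E := InnerProductSpace.ofCore core.toCore
  obtain ⟨F, g, hg, h⟩ := ggcf_abs y a hpos
  refine ⟨F, g, hg, fun l m => orthonormal_iff_ite.mp F.orthonormal l m, fun φ => ?_⟩
  have hy : ∀ j, y j = ∑ l, inner ℝ (F l) (y j) • F l := fun j => (F.sum_repr' (y j)).symm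
  calc ∑ j, ∑ k, a j k • φ (y j) (y k)
      = ∑ j, ∑ k, ∑ l, ∑ m, (a j k * (inner ℝ (F l) (y j) * inner ℝ (F m) (y k))) • φ (F l) (F m) := by
        refine Finset.sum_congr rfl fun j _ => Finset.sum_congr rfl fun k _ => ?_
        conv_lhs => rw [hy j, hy k]
        simp only [map_sum, LinearMap.sum_apply, map_smul, LinearMap.smul_apply, Finset.smul_sum,
          smul_smul]
        rw [Finset.sum_comm]
        refine Finset.sum_congr rfl fun l _ => Finset.sum_congr rfl fun m _ => ?_
        congr 1; ring
    _ = ∑ l, ∑ m, (∑ j, ∑ k, a j k * (inner ℝ (F l) (y j) * inner ℝ (F m) (y k))) • φ (F l) (F m) := by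
        simp only [Finset.sum_smul]
        exact (Finset.sum_congr rfl fun j _ => (Finset.sum_comm.trans
          (Finset.sum_congr rfl fun l _ => Finset.sum_comm))).trans
          (Finset.sum_comm.trans (Finset.sum_congr rfl fun l _ => Finset.sum_comm))
    _ = _ := by
        simp only [h]
        simp [ite_smul]

theorem ggcf_trace_star {H : Type*} [NormedAddCommGroup H] [InnerProductSpace ℂ H]
    [FiniteDimensional ℂ H] (C : H →L[ℂ] H) :
    LinearMap.trace ℂ H ((star C : H →L[ℂ] H) : H →ₗ[ℂ] H)
      = star (LinearMap.trace ℂ H (C : H →ₗ[ℂ] H)) := by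
  rw [LinearMap.trace_eq_sum_inner _ (stdOrthonormalBasis ℂ H),
    LinearMap.trace_eq_sum_inner _ (stdOrthonormalBasis ℂ H), star_sum]
  refine Finset.sum_congr rfl fun i _ => ?_
  simp [ContinuousLinearMap.star_eq_adjoint, ContinuousLinearMap.adjoint_inner_right]

theorem ggcf_trace_pos {H : Type*} [NormedAddCommGroup H] [InnerProductSpace ℂ H]
    [FiniteDimensional ℂ H] (C : H →L[ℂ] H) :
    LinearMap.trace ℂ H ((star C * C : H →L[ℂ] H) : H →ₗ[ℂ] H)
      = ((∑ i, ‖C (stdOrthonormalBasis ℂ H i)‖ ^ 2 : ℝ) : ℂ) := by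
  rw [LinearMap.trace_eq_sum_inner _ (stdOrthonormalBasis ℂ H)]
  push_cast
  refine Finset.sum_congr rfl fun i _ => ?_
  simp [ContinuousLinearMap.star_eq_adjoint, ContinuousLinearMap.adjoint_inner_right,
    inner_self_eq_norm_sq_to_K]

theorem gaussian_generator_canonical_form
    {H : Type*} [NormedAddCommGroup H] [InnerProductSpace ℂ H] [FiniteDimensional ℂ H]
    (n : ℕ) (X : Fin n → (H →L[ℂ] H))
    (hskew : ∀ j, star (X j) = -X j)
    (b : Fin n → ℝ) (a : Matrix (Fin n) (Fin n) ℝ)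
    (hsymm : a.IsSymm) (hpos : a.PosSemidef)
    (V : Submodule ℝ (H →L[ℂ] H))
    (hV : (V : Set (H →L[ℂ] H)) =
      {B | ∃ C ∈ Submodule.span ℝ (Set.range fun j => Complex.I • X j),
        B = C - ((LinearMap.trace ℂ H (C : H →ₗ[ℂ] H)) / (Module.finrank ℂ H : ℂ))
              • (1 : H →L[ℂ] H)}) :
    ∃ Hh ∈ V, IsSelfAdjoint Hh ∧
      ∃ F : Fin (Module.finrank ℝ V) → (H →L[ℂ] H),
        (∀ k, F k ∈ V) ∧ (∀ k, IsSelfAdjoint (F k)) ∧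
        (∀ j k, LinearMap.trace ℂ H ((star (F j) * F k : H →L[ℂ] H) : H →ₗ[ℂ] H)
          = if j = k then 1 else 0) ∧
        ∃ γ : Fin (Module.finrank ℝ V) → ℝ, (∀ k, 0 ≤ γ k) ∧
          ∀ A : H →L[ℂ] H,
            (∑ j, b j • (X j * A - A * X j))
              + (∑ j, ∑ k, a j k •
                  (X j * X k * A + A * (X j * X k) - 2 • (X j * A * X k)))
            = -(Complex.I) • (Hh * A - A * Hh)
              + ∑ k, γ k •
                  (F k * A * F k - (2 : ℂ)⁻¹ • (F k ^ 2 * A + A * F k ^ 2)) := by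
  have hsa : ∀ C ∈ Submodule.span ℝ (Set.range fun j => Complex.I • X j), IsSelfAdjoint C := by
    intro C hC
    have : Submodule.span ℝ (Set.range fun j => Complex.I • X j)
        ≤ selfAdjoint.submodule ℝ (H →L[ℂ] H) := by
      rw [Submodule.span_le]
      rintro _ ⟨j, rfl⟩
      change IsSelfAdjoint (Complex.I • X j)
      rw [isSelfAdjoint_iff, star_smul, hskew]
      simp
    exact this hC
  have hVsa : ∀ B ∈ V, IsSelfAdjoint B := by
    intro B hB
    have hB' : B ∈ (V : Set (H →L[ℂ] H)) := hB
    rw [hV] at hB'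
    obtain ⟨C, hC, rfl⟩ := hB'
    have h1 := hsa C hC
    have h2 := ggcf_trace_star C
    rw [h1.star_eq] at h2
    rw [isSelfAdjoint_iff, star_sub, star_smul, star_div₀, ← h2, h1.star_eq]
    simp
  have hY : ∀ j, ∃ c : ℂ, Complex.I • X j - c • (1 : H →L[ℂ] H) ∈ V := by
    intro j
    refine ⟨(LinearMap.trace ℂ H ((Complex.I • X j : H →L[ℂ] H) : H →ₗ[ℂ] H))
      / (Module.finrank ℂ H : ℂ), ?_⟩
    rw [← SetLike.mem_coe, hV]
    exact ⟨_, Submodule.subset_span ⟨j, rfl⟩, rfl⟩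
  choose c hc using hY
  let y : Fin n → V := fun j => ⟨_, hc j⟩
  have hXy : ∀ j, X j = -(Complex.I) • ((y j : H →L[ℂ] H) + c j • (1 : H →L[ℂ] H)) := by
    intro j
    simp [y, smul_smul]
  let B : V →ₗ[ℝ] V →ₗ[ℝ] ℝ := LinearMap.mk₂ ℝ
    (fun u v => (LinearMap.trace ℂ H ((star (u : H →L[ℂ] H) * v : H →L[ℂ] H) : H →ₗ[ℂ] H)).re)
    (by intro u v w; simp [add_mul]) 
    (by intro r u v; simp)
    (by intro u v w; simp [mul_add])
    (by intro r u v; simp)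
  have hBd : ∀ u v : V, B u v = (LinearMap.trace ℂ H
      ((star (u : H →L[ℂ] H) * v : H →L[ℂ] H) : H →ₗ[ℂ] H)).re := fun _ _ => rfl
  have hcomm : ∀ u v : H →L[ℂ] H, LinearMap.trace ℂ H ((u * v : H →L[ℂ] H) : H →ₗ[ℂ] H)
      = LinearMap.trace ℂ H ((v * u : H →L[ℂ] H) : H →ₗ[ℂ] H) := fun u v =>
    LinearMap.trace_mul_comm ℂ (u : H →ₗ[ℂ] H) (v : H →ₗ[ℂ] H)
  have hBr : ∀ u v : V, LinearMap.trace ℂ H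
      ((star (u : H →L[ℂ] H) * v : H →L[ℂ] H) : H →ₗ[ℂ] H) = (B u v : ℂ) := by
    intro u v
    have h1 := ggcf_trace_star (star (u : H →L[ℂ] H) * (v : H →L[ℂ] H))
    rw [star_mul, star_star, (hVsa v v.2).star_eq, hcomm] at h1
    nth_rewrite 1 [← (hVsa u u.2).star_eq] at h1
    exact (Complex.conj_eq_iff_re.mp h1.symm).symm
  obtain ⟨F, g, hg, hF, hφ⟩ := ggcf_bilin B
    (by
      intro u v
      rw [hBd, hBd, (hVsa u u.2).star_eq, (hVsa v v.2).star_eq, hcomm])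
    (by
      intro u
      rw [hBd, ggcf_trace_pos, Complex.ofReal_re]
      positivity)
    (by
      intro u hu
      rw [hBd] at hu
      rw [ggcf_trace_pos, Complex.ofReal_re,
        Finset.sum_eq_zero_iff_of_nonneg (fun i _ => by positivity)] at hu
      have h0 : ((u : H →L[ℂ] H) : H →ₗ[ℂ] H) = 0 := by
        refine (stdOrthonormalBasis ℂ H).toBasis.ext fun i => ?_
        simpa using hu i (Finset.mem_univ i)
      ext x
      exact LinearMap.congr_fun h0 x) y a hpos
  refine ⟨((∑ j, b j • y j : V) : H →L[ℂ] H), SetLike.coe_mem _, hVsa _ (SetLike.coe_mem _),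
    fun k => F k, fun k => (F k).2, fun k => hVsa _ (F k).2, ?_, fun k => 2 * g k,
    fun k => by have := hg k; positivity, ?_⟩
  · intro j k
    rw [hBr, hF]
    split_ifs <;> simp
  intro A
  let φ : V →ₗ[ℝ] V →ₗ[ℝ] (H →L[ℂ] H) := LinearMap.mk₂ ℝ
    (fun u v => (2 : ℝ) • ((u : H →L[ℂ] H) * A * v)
      - ((u : H →L[ℂ] H) * v * A + A * ((u : H →L[ℂ] H) * v)))
    (by intro u v w; simp only [Submodule.coe_add, add_mul, mul_add]; module)
    (by intro r u v; simp only [Submodule.coe_smul, smul_mul_assoc, mul_smul_comm]; module)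
    (by intro u v w; simp only [Submodule.coe_add, add_mul, mul_add]; module)
    (by intro r u v; simp only [Submodule.coe_smul, smul_mul_assoc, mul_smul_comm]; module)
  have h2 := hφ φ
  congr 1
  · rw [Submodule.coe_sum, Finset.sum_mul, Finset.mul_sum, ← Finset.sum_sub_distrib,
      Finset.smul_sum]
    refine Finset.sum_congr rfl fun j _ => ?_
    rw [hXy]
    simp only [Submodule.coe_smul, smul_mul_assoc, mul_smul_comm, add_mul, mul_add, one_mul,
      mul_one]
    module
  · have h3 : ∑ k, (2 * g k) • ((F k : H →L[ℂ] H) * A * F k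
        - (2 : ℂ)⁻¹ • ((F k : H →L[ℂ] H) ^ 2 * A + A * (F k : H →L[ℂ] H) ^ 2))
        = ∑ l, g l • φ (F l) (F l) := by
      refine Finset.sum_congr rfl fun k _ => ?_
      simp only [φ, LinearMap.mk₂_apply, sq]
      module
    rw [h3, ← h2]
    have h4 : ∀ j k, a j k • (X j * X k * A + A * (X j * X k) - 2 • (X j * A * X k))
        = a j k • φ (y j) (y k)
          + (a j k • (c k • ((y j : H →L[ℂ] H) * A - A * y j))
            - a j k • (c j • ((y k : H →L[ℂ] H) * A - A * y k))) := by
      intro j k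
      have hI : Complex.I * Complex.I = -1 := Complex.I_mul_I
      rw [← smul_sub, ← smul_add]
      congr 1
      simp only [φ, LinearMap.mk₂_apply]
      rw [hXy j, hXy k]
      simp only [smul_mul_assoc, mul_smul_comm, smul_smul, neg_mul_neg, hI]
      simp only [smul_mul_assoc, mul_smul_comm, add_mul, mul_add, one_mul, mul_one]
      module
    simp only [h4, Finset.sum_add_distrib, Finset.sum_sub_distrib]
    rw [add_eq_left, sub_eq_zero, Finset.sum_comm]
    refine Finset.sum_congr rfl fun j _ => Finset.sum_congr rfl fun k _ => ?_
    rw [hsymm.apply]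
end
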